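/- For every p ∈ (0,1), the Bhattacharyya coefficient satisfies C_p^{1/2} ≤ min{ p/(√p + √(1−p)) + (√(p(1−p))/(√p + √(1−p))) ℙ₁(𝒴′₁) + C₀^{1/2} ( (1−p)/(√p + √(1−p)) + (√(p(1−p))/(√p + √(1−p))) ℙ₀₁(𝒴′₀) ), 1 }, where 𝒴′₀ = {y : f₁(y) < f₀(y)}, 𝒴′₁ = {y : f₁(y) > f₀(y)}, ℙ₁ denotes the probability measure with density f₁, and ℙ₀₁ denotes the probability measure with density f₀₁(y) = φ( y ; (μ/2)/(1 + t/2) , ((1+t)/(1 + t/2)) · σ²/t ). -/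

import Mathlib

open MeasureTheory Real

/-- Gaussian probability density with mean `m` and variance `v`. -/
noncomputable def gaussPdf (m v y : ℝ) : ℝ :=
  Real.exp (-(y - m) ^ 2 / (2 * v)) / Real.sqrt (2 * Real.pi * v)

lemma gp_eq (m v : ℝ) (hv : 0 < v) :
    gaussPdf m v = ProbabilityTheory.gaussianPDFReal m ⟨v, hv.le⟩ := by
  funext y
  simp only [gaussPdf, ProbabilityTheory.gaussianPDFReal]
  rw [div_eq_inv_mul]
  rfl

lemma gp_int (m v : ℝ) (hv : 0 < v) : Integrable (gaussPdf m v) := by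
  rw [gp_eq m v hv]; exact ProbabilityTheory.integrable_gaussianPDFReal _ _

lemma gp_one (m v : ℝ) (hv : 0 < v) : ∫ y, gaussPdf m v y = 1 := by
  rw [gp_eq m v hv]
  apply ProbabilityTheory.integral_gaussianPDFReal_eq_one
  intro h
  exact hv.ne' (congrArg NNReal.toReal h)

lemma gp_pos (m v : ℝ) (hv : 0 < v) (y : ℝ) : 0 < gaussPdf m v y := by
  unfold gaussPdf
  have := Real.pi_pos
  positivity

lemma gp_cont (m v : ℝ) : Continuous (gaussPdf m v) := by
  unfold gaussPdf
  fun_prop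

lemma gp_log (m v : ℝ) (hv : 0 < v) (y : ℝ) :
    Real.log (gaussPdf m v y) = -(y - m) ^ 2 / (2 * v) - Real.log (Real.sqrt (2 * Real.pi * v)) := by
  unfold gaussPdf
  have := Real.pi_pos
  rw [Real.log_div (Real.exp_pos _).ne' (by positivity), Real.log_exp]

lemma quad_null (A B C : ℝ) (hA : A ≠ 0) : volume {y : ℝ | A * y ^ 2 + B * y + C = 0} = 0 := by
  apply Set.Finite.measure_zero
  have hP : (Polynomial.C A * Polynomial.X ^ 2 + Polynomial.C B * Polynomial.X
      + Polynomial.C C : Polynomial ℝ) ≠ 0 := by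
    intro h
    have := congrArg (fun q => Polynomial.coeff q 2) h
    simp [Polynomial.coeff_X, Polynomial.coeff_C] at this
    exact hA this
  refine (Polynomial.finite_setOfPred_isRoot hP).subset ?_
  intro y hy
  simpa [Polynomial.IsRoot] using hy

lemma gp_eq_null (m₁ v₁ m₀ v₀ : ℝ) (h₁ : 0 < v₁) (h₀ : 0 < v₀) (hne : v₁ ≠ v₀) :
    ∀ᵐ y : ℝ, gaussPdf m₁ v₁ y ≠ gaussPdf m₀ v₀ y := by
  rw [ae_iff]
  refine measure_mono_null ?_ (quad_null (1 / (2 * v₀) - 1 / (2 * v₁))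
    (m₁ / v₁ - m₀ / v₀)
    (m₀ ^ 2 / (2 * v₀) - m₁ ^ 2 / (2 * v₁) - Real.log (Real.sqrt (2 * Real.pi * v₁))
      + Real.log (Real.sqrt (2 * Real.pi * v₀))) ?_)
  · intro y hy
    simp only [ne_eq, not_not, Set.mem_ofPred_eq] at hy ⊢
    have h := congrArg Real.log hy
    rw [gp_log _ _ h₁, gp_log _ _ h₀] at h
    have e1 : -(y - m₁) ^ 2 / (2 * v₁) =
      -(1 / (2 * v₁)) * y ^ 2 + m₁ / v₁ * y - m₁ ^ 2 / (2 * v₁) := by field_simp; ring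
    have e0 : -(y - m₀) ^ 2 / (2 * v₀) =
      -(1 / (2 * v₀)) * y ^ 2 + m₀ / v₀ * y - m₀ ^ 2 / (2 * v₀) := by field_simp; ring
    rw [e1, e0] at h
    linarith
  · intro h
    apply hne
    field_simp at h
    linarith

lemma gp_prod (μ σ t : ℝ) (hσ : 0 < σ) (ht : 0 < t) : ∃ K : ℝ, ∀ y,
    Real.sqrt (gaussPdf μ (σ ^ 2 * (1 + 1 / t)) y * gaussPdf 0 (σ ^ 2 / t) y) =
    K * gaussPdf ((μ / 2) / (1 + t / 2)) (((1 + t) / (1 + t / 2)) * (σ ^ 2 / t)) y := by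
  have hv : 0 < ((1 + t) / (1 + t / 2)) * (σ ^ 2 / t) := by positivity
  have hpi := Real.pi_pos
  have hs : 0 < Real.sqrt (2 * Real.pi * (((1 + t) / (1 + t / 2)) * (σ ^ 2 / t))) := by positivity
  refine ⟨Real.exp (-(μ ^ 2 * t) / (4 * σ ^ 2 * (1 + t / 2)) / 2) *
    Real.sqrt (2 * Real.pi * (((1 + t) / (1 + t / 2)) * (σ ^ 2 / t))) /
    Real.sqrt (Real.sqrt (2 * Real.pi * (σ ^ 2 * (1 + 1 / t))) *
      Real.sqrt (2 * Real.pi * (σ ^ 2 / t))), fun y => ?_⟩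
  unfold gaussPdf
  rw [div_mul_div_comm, Real.sqrt_div (by positivity), ← Real.exp_add, ← Real.exp_half]
  have e : (-(y - μ) ^ 2 / (2 * (σ ^ 2 * (1 + 1 / t))) + -(y - 0) ^ 2 / (2 * (σ ^ 2 / t))) / 2
    = -(μ ^ 2 * t) / (4 * σ ^ 2 * (1 + t / 2)) / 2 +
      -(y - (μ / 2) / (1 + t / 2)) ^ 2 / (2 * (((1 + t) / (1 + t / 2)) * (σ ^ 2 / t))) := by
    field_simp
    ring
  rw [e, Real.exp_add]
  field_simp

lemma key (a b u v : ℝ) (ha : 0 < a) (hb : 0 < b) (hu : 0 < u) (hv : 0 < v) (h : v ≤ u) :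
    Real.sqrt (a ^ 2 * u ^ 2 + b ^ 2 * v ^ 2) ≤ a * u + b ^ 2 / (a + b) * v := by
  apply Real.sqrt_le_iff.2
  refine ⟨by positivity, ?_⟩
  have : (a * u + b ^ 2 / (a + b) * v) ^ 2 - (a ^ 2 * u ^ 2 + b ^ 2 * v ^ 2)
    = a * b ^ 2 * v * (2 * (a + b) * (u - v) + a * v) / (a + b) ^ 2 := by
    field_simp
    ring
  have h2 : 0 ≤ a * b ^ 2 * v * (2 * (a + b) * (u - v) + a * v) / (a + b) ^ 2 := by
    have := sub_nonneg.2 h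
    positivity
  linarith

lemma key2 (p x z : ℝ) (hp0 : 0 < p) (hp1 : p < 1) (hx : 0 < x) (hz : 0 < z) :
    (z < x → Real.sqrt (x * (p * x + (1 - p) * z)) ≤
      p / (Real.sqrt p + Real.sqrt (1 - p)) * x
      + Real.sqrt (p * (1 - p)) / (Real.sqrt p + Real.sqrt (1 - p)) * x
      + (1 - p) / (Real.sqrt p + Real.sqrt (1 - p)) * Real.sqrt (x * z)) ∧
    (x < z → Real.sqrt (x * (p * x + (1 - p) * z)) ≤
      p / (Real.sqrt p + Real.sqrt (1 - p)) * x
      + (1 - p) / (Real.sqrt p + Real.sqrt (1 - p)) * Real.sqrt (x * z)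
      + Real.sqrt (p * (1 - p)) / (Real.sqrt p + Real.sqrt (1 - p)) * Real.sqrt (x * z)) := by
  have hq : 0 < 1 - p := by linarith
  rw [Real.sqrt_mul hp0.le, Real.sqrt_mul hx.le, Real.sqrt_mul hx.le]
  have ha := Real.sqrt_pos.2 hp0
  have hb := Real.sqrt_pos.2 hq
  have hu := Real.sqrt_pos.2 hx
  have hv := Real.sqrt_pos.2 hz
  have ea := Real.sq_sqrt hp0.le
  have eb := Real.sq_sqrt hq.le
  have eu := Real.sq_sqrt hx.le
  have ev := Real.sq_sqrt hz.le
  have k1 := key _ _ _ _ ha hb hu hv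
  have k2 := key _ _ _ _ hb ha hv hu
  rw [ea, eb, eu, ev] at k1 k2
  rw [add_comm ((1 - p) * z), add_comm (Real.sqrt (1 - p)) (Real.sqrt p)] at k2
  generalize Real.sqrt (p * x + (1 - p) * z) = w at *
  generalize hA : Real.sqrt p = a at *
  generalize hB : Real.sqrt (1 - p) = b at *
  generalize hU : Real.sqrt x = u at *
  generalize hV : Real.sqrt z = v at *
  constructor
  · intro h
    have h' : v ≤ u := by rw [← hU, ← hV]; exact Real.sqrt_le_sqrt h.le
    calc u * w ≤ u * (a * u + (1 - p) / (a + b) * v) := by gcongr; exact k1 h'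
      _ = _ := by
        rw [← ea, ← eu, ea]
        rw [show p = a ^ 2 from ea.symm]
        field_simp
  · intro h
    have h' : u ≤ v := by rw [← hU, ← hV]; exact Real.sqrt_le_sqrt h.le
    calc u * w ≤ u * (b * v + p / (a + b) * u) := by gcongr; exact k2 h'
      _ = _ := by
        rw [← eb, ← eu]
        field_simp
        ring

/-- Upper bound on the Bhattacharyya coefficient `C_p^{1/2}` (Proposition 2). -/
theorem bhattacharyya_coefficient_upper_bound (μ σ p t : ℝ) (hσ : 0 < σ) (ht : 0 < t)
    (hp : p ∈ Set.Ioo (0 : ℝ) 1)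
    (f₀ f₁ f01 : ℝ → ℝ)
    (hf₀ : f₀ = fun y => gaussPdf 0 (σ ^ 2 / t) y)
    (hf₁ : f₁ = fun y => gaussPdf μ (σ ^ 2 * (1 + 1 / t)) y)
    (hf01 : f01 = fun y =>
      gaussPdf ((μ / 2) / (1 + t / 2)) (((1 + t) / (1 + t / 2)) * (σ ^ 2 / t)) y)
    (Cp C0 : ℝ)
    (hCp : Cp = ∫ y : ℝ, Real.sqrt (f₁ y * (p * f₁ y + (1 - p) * f₀ y)))
    (hC0 : C0 = ∫ y : ℝ, Real.sqrt (f₁ y * f₀ y)) :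
    Cp ≤ min
      (p / (Real.sqrt p + Real.sqrt (1 - p))
        + (Real.sqrt (p * (1 - p)) / (Real.sqrt p + Real.sqrt (1 - p))) *
            (∫ y in {y : ℝ | f₁ y > f₀ y}, f₁ y)
        + C0 * ((1 - p) / (Real.sqrt p + Real.sqrt (1 - p))
            + (Real.sqrt (p * (1 - p)) / (Real.sqrt p + Real.sqrt (1 - p))) *
                ∫ y in {y : ℝ | f₁ y < f₀ y}, f01 y))
      1 := by
  obtain ⟨hp0, hp1⟩ := hp
  have hv0 : 0 < σ ^ 2 / t := by positivity
  have hv1 : 0 < σ ^ 2 * (1 + 1 / t) := by positivity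
  have hv01 : 0 < ((1 + t) / (1 + t / 2)) * (σ ^ 2 / t) := by positivity
  have hvne : σ ^ 2 * (1 + 1 / t) ≠ σ ^ 2 / t := by
    have : σ ^ 2 * (1 + 1 / t) = σ ^ 2 + σ ^ 2 / t := by ring
    have := pow_pos hσ 2
    intro h; linarith
  have i0 := gp_int 0 _ hv0
  have i1 := gp_int μ _ hv1
  have i01 := gp_int ((μ / 2) / (1 + t / 2)) _ hv01
  have o0 := gp_one 0 _ hv0
  have o1 := gp_one μ _ hv1
  have o01 := gp_one ((μ / 2) / (1 + t / 2)) _ hv01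
  have p0 := gp_pos 0 _ hv0
  have p1 := gp_pos μ _ hv1
  have c0 := gp_cont 0 (σ ^ 2 / t)
  have c1 := gp_cont μ (σ ^ 2 * (1 + 1 / t))
  have hne := gp_eq_null μ _ 0 _ hv1 hv0 hvne
  obtain ⟨K, hK⟩ := gp_prod μ σ t hσ ht
  change f₀ = gaussPdf 0 (σ ^ 2 / t) at hf₀
  change f₁ = gaussPdf μ (σ ^ 2 * (1 + 1 / t)) at hf₁
  change f01 = gaussPdf ((μ / 2) / (1 + t / 2)) (((1 + t) / (1 + t / 2)) * (σ ^ 2 / t)) at hf01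
  rw [← hf₀] at i0 o0 p0 c0 hne hK
  rw [← hf₁] at i1 o1 p1 c1 hne hK
  rw [← hf01] at i01 o01 hK
  clear hf₀ hf₁ hf01
  have hKC : K = C0 := by
    rw [hC0]; simp_rw [hK]; rw [integral_const_mul, o01, mul_one]
  rw [hKC] at hK
  have hq : 0 < 1 - p := by linarith
  have imix : Integrable (fun y => p * f₁ y + (1 - p) * f₀ y) :=
    (i1.const_mul p).add (i0.const_mul (1 - p))
  have omix : ∫ y, (p * f₁ y + (1 - p) * f₀ y) = 1 := by
    rw [integral_add (i1.const_mul p) (i0.const_mul (1 - p)), integral_const_mul,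
      integral_const_mul, o0, o1]; ring
  have idom : Integrable (fun y => (f₁ y + (p * f₁ y + (1 - p) * f₀ y)) / 2) :=
    (i1.add imix).div_const 2
  have hamgm : ∀ y, Real.sqrt (f₁ y * (p * f₁ y + (1 - p) * f₀ y)) ≤
      (f₁ y + (p * f₁ y + (1 - p) * f₀ y)) / 2 := by
    intro y
    have h1 := p1 y
    have h0 := p0 y
    apply Real.sqrt_le_iff.2
    refine ⟨by positivity, ?_⟩
    nlinarith [sq_nonneg (f₁ y - (p * f₁ y + (1 - p) * f₀ y))]
  have iL : Integrable (fun y => Real.sqrt (f₁ y * (p * f₁ y + (1 - p) * f₀ y))) := by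
    refine idom.mono' (by fun_prop) (Filter.Eventually.of_forall fun y => ?_)
    rw [Real.norm_of_nonneg (Real.sqrt_nonneg _)]
    exact hamgm y
  apply le_min
  · have mS1 : MeasurableSet {y : ℝ | f₁ y > f₀ y} := measurableSet_lt c0.measurable c1.measurable
    have mS0 : MeasurableSet {y : ℝ | f₁ y < f₀ y} := measurableSet_lt c1.measurable c0.measurable
    have ih : Integrable (fun y => Real.sqrt (f₁ y * f₀ y)) := by
      simp_rw [hK]; exact i01.const_mul _
    have hS0 : C0 * ∫ y in {y : ℝ | f₁ y < f₀ y}, f01 y =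
        ∫ y in {y : ℝ | f₁ y < f₀ y}, Real.sqrt (f₁ y * f₀ y) := by
      simp_rw [hK]; rw [integral_const_mul]
    have hpt := fun y => key2 p (f₁ y) (f₀ y) hp0 hp1 (p1 y) (p0 y)
    generalize p / (Real.sqrt p + Real.sqrt (1 - p)) = α at *
    generalize (1 - p) / (Real.sqrt p + Real.sqrt (1 - p)) = γ at *
    generalize Real.sqrt (p * (1 - p)) / (Real.sqrt p + Real.sqrt (1 - p)) = β at *
    have j1 : Integrable (fun y => α * f₁ y) := i1.const_mul α
    have j2 : Integrable (fun y => β * Set.indicator {y : ℝ | f₁ y > f₀ y} f₁ y) :=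
      (i1.indicator mS1).const_mul β
    have j3 : Integrable (fun y => γ * Real.sqrt (f₁ y * f₀ y)) := ih.const_mul γ
    have j4 : Integrable (fun y => β * Set.indicator {y : ℝ | f₁ y < f₀ y}
        (fun y => Real.sqrt (f₁ y * f₀ y)) y) := (ih.indicator mS0).const_mul β
    have hle : Cp ≤ ∫ y, (((α * f₁ y + β * Set.indicator {y : ℝ | f₁ y > f₀ y} f₁ y)
        + γ * Real.sqrt (f₁ y * f₀ y)) + β * Set.indicator {y : ℝ | f₁ y < f₀ y}
        (fun y => Real.sqrt (f₁ y * f₀ y)) y) := by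
      rw [hCp]
      refine integral_mono_ae iL (((j1.add j2).add j3).add j4) ?_
      filter_upwards [hne] with y hy
      rcases lt_or_gt_of_ne hy with h | h
      · have := (hpt y).2 h
        simpa [Set.indicator, h, h.le, not_lt.2 h.le] using this
      · have := (hpt y).1 h
        simpa [Set.indicator, h, h.le, not_lt.2 h.le] using this
    refine hle.trans (le_of_eq ?_)
    have j12 : Integrable (fun y => α * f₁ y + β * Set.indicator {y : ℝ | f₁ y > f₀ y} f₁ y) :=
      j1.add j2
    have j123 : Integrable (fun y => α * f₁ y + β * Set.indicator {y : ℝ | f₁ y > f₀ y} f₁ y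
        + γ * Real.sqrt (f₁ y * f₀ y)) := j12.add j3
    rw [integral_add j123 j4, integral_add j12 j3, integral_add j1 j2,
      integral_const_mul, integral_const_mul, integral_const_mul, integral_const_mul,
      integral_indicator mS1, integral_indicator mS0, ← hS0, o1, ← hC0]
    ring
  · rw [hCp]
    refine (integral_mono iL idom hamgm).trans (le_of_eq ?_)
    rw [integral_div, integral_add i1 imix, omix, o1]
    norm_num
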